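/- arXiv:1703.06382 — 5 statements merged into one kernel-verified Lean document; each statement's English description precedes it below -/
import Mathlib

section
/- Let λ = (λ_1,…,λ_ℓ) be a partition of n with ℓ nonzero parts. Then f^λ = n! / (h(1,1)! · h(2,1)! ⋯ h(ℓ,1)!) · ∏_{1 ≤ j_1 < j_2 ≤ ℓ} (h(j_1,1) − h(j_2,1)), where h(i,1) denotes the hook length of the cell in row i of the first column of λ. -/
namespace HK

abbrev SYT (μ : YoungDiagram) := {T : ℕ × ℕ → ℕ //
    (∀ c, c ∉ μ → T c = 0) ∧
    Set.BijOn T (↑μ.cells) (Set.Icc 1 μ.card) ∧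
    (∀ i j₁ j₂, (i, j₁) ∈ μ → (i, j₂) ∈ μ → j₁ < j₂ → T (i, j₁) < T (i, j₂)) ∧
    (∀ i₁ i₂ j, (i₁, j) ∈ μ → (i₂, j) ∈ μ → i₁ < i₂ → T (i₁, j) < T (i₂, j))}

/-! Algebraic identities -/

def A (x : ℕ → ℚ) (t : ℚ) (s : Finset ℕ) (k : ℕ) : ℚ :=
  ∏ j ∈ s.erase k, (1 + t / (x k - x j))

lemma A_insert_old (x : ℕ → ℚ) (t : ℚ) (s : Finset ℕ) (k w : ℕ) (hw : w ∉ s) (hk : k ∈ s) :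
    A x t (insert w s) k = (1 + t / (x k - x w)) * A x t s k := by
  have hne : w ≠ k := by rintro rfl; exact hw hk
  unfold A
  rw [Finset.erase_insert_of_ne hne, Finset.prod_insert (by simp [hw])]

lemma A_insert_new (x : ℕ → ℚ) (t : ℚ) (s : Finset ℕ) (w : ℕ) (hw : w ∉ s) :
    A x t (insert w s) w = ∏ j ∈ s, (1 + t / (x w - x j)) := by
  unfold A
  rw [Finset.erase_insert hw]

lemma pf (x : ℕ → ℚ) (hx : Function.Injective x) (t : ℚ) (s : Finset ℕ) :
    ∀ z : ℚ, (∀ j ∈ s, z ≠ x j) →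
      ∏ j ∈ s, (1 + t / (z - x j)) = 1 + ∑ k ∈ s, A x t s k * (t / (z - x k)) := by
  induction s using Finset.induction_on with
  | empty => simp
  | insert w s hw ih =>
    intro z hz
    have hzw : z - x w ≠ 0 := sub_ne_zero.2 (hz w (by simp))
    have hwj : ∀ j ∈ s, x w ≠ x j := fun j hj h => hw (hx h ▸ hj)
    rw [Finset.prod_insert hw, Finset.sum_insert hw, A_insert_new _ _ _ _ hw,
      ih z (fun j hj => hz j (by simp [hj])), ih (x w) hwj]
    have : ∀ k ∈ s, A x t (insert w s) k * (t / (z - x k)) =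
        A x t s k * (t / (z - x k)) * (1 + t / (z - x w))
          - A x t s k * (t / (x w - x k)) * (t / (z - x w)) := by
      intro k hk
      rw [A_insert_old _ _ _ _ _ hw hk]
      have h1 : z - x k ≠ 0 := sub_ne_zero.2 (hz k (by simp [hk]))
      have h2 : x w - x k ≠ 0 := sub_ne_zero.2 (hwj k hk)
      have h3 : x k - x w ≠ 0 := sub_ne_zero.2 (hwj k hk).symm
      rw [show t / (x w - x k) = - (t / (x k - x w)) by
        rw [← neg_sub, div_neg]]
      field_simp
      ring
    rw [Finset.sum_congr rfl this, Finset.sum_sub_distrib, ← Finset.sum_mul, ← Finset.sum_mul]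
    ring

lemma new_eq (x : ℕ → ℚ) (hx : Function.Injective x) (t : ℚ) (s : Finset ℕ) (w : ℕ) (hw : w ∉ s) :
    A x t (insert w s) w = 1 + ∑ k ∈ s, A x t s k * (t / (x w - x k)) := by
  rw [A_insert_new _ _ _ _ hw, pf x hx]
  exact fun j hj h => hw (hx h ▸ hj)

lemma sumA (x : ℕ → ℚ) (hx : Function.Injective x) (t : ℚ) (s : Finset ℕ) :
    ∑ k ∈ s, A x t s k = s.card := by
  induction s using Finset.induction_on with
  | empty => simp
  | insert w s hw ih =>
    rw [Finset.sum_insert hw, new_eq x hx t s w hw, Finset.card_insert_of_notMem hw]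
    have : ∀ k ∈ s, A x t (insert w s) k = A x t s k - A x t s k * (t / (x w - x k)) := by
      intro k hk
      rw [A_insert_old _ _ _ _ _ hw hk, ← neg_sub (x w), div_neg]; ring
    rw [Finset.sum_congr rfl this, Finset.sum_sub_distrib, ih]
    push_cast; ring

lemma sumxA (x : ℕ → ℚ) (hx : Function.Injective x) (t : ℚ) (s : Finset ℕ) :
    ∑ k ∈ s, x k * A x t s k = ∑ k ∈ s, x k + t * (s.card * (s.card - 1) / 2) := by
  induction s using Finset.induction_on with
  | empty => simp
  | insert w s hw ih =>
    rw [Finset.sum_insert hw, Finset.sum_insert hw, new_eq x hx t s w hw,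
      Finset.card_insert_of_notMem hw]
    have : ∀ k ∈ s, x k * A x t (insert w s) k =
        x k * A x t s k + t * A x t s k - x w * (A x t s k * (t / (x w - x k))) := by
      intro k hk
      have h2 : x w - x k ≠ 0 := sub_ne_zero.2 (fun h => hw (hx h ▸ hk))
      rw [A_insert_old _ _ _ _ _ hw hk, ← neg_sub (x w), div_neg]
      field_simp
      ring
    rw [Finset.sum_congr rfl this, Finset.sum_sub_distrib, Finset.sum_add_distrib, ih,
      ← Finset.mul_sum, ← Finset.mul_sum, sumA x hx]
    push_cast; ring

def pairs (L : ℕ) : Finset (ℕ × ℕ) :=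
  (Finset.range L ×ˢ Finset.range L).filter (fun p => p.1 < p.2)

lemma vdm_ratio (x : ℕ → ℚ) (hx : Function.Injective x) (t : ℚ) (L k : ℕ) (hk : k < L) :
    ∏ p ∈ pairs L, (Function.update x k (x k + t) p.1 - Function.update x k (x k + t) p.2) =
      (∏ p ∈ pairs L, (x p.1 - x p.2)) * A x t (Finset.range L) k := by
  set y := Function.update x k (x k + t) with hy
  have hyk : y k = x k + t := by simp [hy]
  have hyo : ∀ j, j ≠ k → y j = x j := fun j hj => by simp [hy, hj]
  have hne : ∀ i j, i ≠ j → x i - x j ≠ 0 := fun i j h => sub_ne_zero.2 (fun h' => h (hx h'))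
  have : A x t (Finset.range L) k = ∏ p ∈ pairs L, ((y p.1 - y p.2) / (x p.1 - x p.2)) := by
    unfold A
    apply Finset.prod_of_injOn (fun j => (min j k, max j k))
    · intro a _ b _ h
      simp only [Prod.mk.injEq] at h
      omega
    · intro a ha
      simp [pairs] at ha ⊢
      omega
    · rintro ⟨i, j⟩ hp hni
      simp only [pairs, Finset.mem_filter, Finset.mem_product, Finset.mem_range] at hp
      simp only [Set.mem_image, not_exists, not_and, Finset.mem_coe, Finset.mem_erase,
        Finset.mem_range, Prod.mk.injEq] at hni
      have hi : i ≠ k := by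
        rintro rfl
        exact hni j ⟨by omega, by omega⟩ (by omega) (by omega)
      have hj : j ≠ k := by
        rintro rfl
        exact hni i ⟨by omega, by omega⟩ (by omega) (by omega)
      simp only [hyo i hi, hyo j hj]
      exact div_self (hne i j (by omega))
    · intro j hj
      simp only [Finset.mem_erase, Finset.mem_range] at hj
      have h1 := hne k j (Ne.symm hj.1)
      have h2 := hne j k hj.1
      rcases lt_or_gt_of_ne hj.1 with h | h
      · simp only [min_eq_left h.le, max_eq_right h.le, hyk, hyo j hj.1]
        rw [← neg_sub (x j), div_neg]
        field_simp
        ring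
      · simp only [min_eq_right h.le, max_eq_left h.le, hyk, hyo j hj.1]
        field_simp
        ring
  rw [this, ← Finset.prod_mul_distrib]
  apply Finset.prod_congr rfl
  rintro ⟨i, j⟩ hp
  simp only [pairs, Finset.mem_filter, Finset.mem_product, Finset.mem_range] at hp
  have := hne i j (by omega)
  field_simp

/-! Corners -/

def corners (μ : YoungDiagram) : Finset (ℕ × ℕ) :=
  μ.cells.filter (fun c => (c.1 + 1, c.2) ∉ μ ∧ (c.1, c.2 + 1) ∉ μ)

lemma mem_corners {μ : YoungDiagram} {c : ℕ × ℕ} :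
    c ∈ corners μ ↔ c ∈ μ ∧ (c.1 + 1, c.2) ∉ μ ∧ (c.1, c.2 + 1) ∉ μ := by
  simp [corners]

def del (μ : YoungDiagram) (c : ℕ × ℕ) (hc : c ∈ corners μ) : YoungDiagram where
  cells := μ.cells.erase c
  isLowerSet := by
    intro b a hab hb
    rw [mem_corners] at hc
    simp only [Finset.coe_erase, Set.mem_sdiff, Finset.mem_coe, Set.mem_singleton_iff,
      YoungDiagram.mem_cells] at hb ⊢
    refine ⟨μ.isLowerSet hab hb.1, ?_⟩
    rintro rfl
    rcases lt_or_eq_of_le hab.1 with h | h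
    · exact hc.2.1 (μ.isLowerSet (show (a.1 + 1, a.2) ≤ b from ⟨h, hab.2⟩) hb.1)
    · rcases lt_or_eq_of_le hab.2 with h' | h'
      · exact hc.2.2 (μ.isLowerSet (show (a.1, a.2 + 1) ≤ b from ⟨hab.1, h'⟩) hb.1)
      · exact hb.2 (Prod.ext h.symm h'.symm)

lemma mem_del {μ : YoungDiagram} {c : ℕ × ℕ} {hc : c ∈ corners μ} {d : ℕ × ℕ} :
    d ∈ del μ c hc ↔ d ≠ c ∧ d ∈ μ := by
  rw [← YoungDiagram.mem_cells]
  simp [del]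

lemma card_del {μ : YoungDiagram} {c : ℕ × ℕ} (hc : c ∈ corners μ) :
    (del μ c hc).card + 1 = μ.card := by
  have : c ∈ μ.cells := by rw [YoungDiagram.mem_cells]; exact (mem_corners.1 hc).1
  exact Finset.card_erase_add_one this

lemma corner_snd {μ : YoungDiagram} {c : ℕ × ℕ} (hc : c ∈ corners μ) :
    c.2 + 1 = μ.rowLen c.1 := by
  obtain ⟨h1, _, h3⟩ := mem_corners.1 hc
  have h1' : (c.1, c.2) ∈ μ := h1
  rw [YoungDiagram.mem_iff_lt_rowLen] at h1' h3
  omega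

lemma rowLen_del {μ : YoungDiagram} {c : ℕ × ℕ} (hc : c ∈ corners μ) (i : ℕ) :
    (del μ c hc).rowLen i = if i = c.1 then μ.rowLen i - 1 else μ.rowLen i := by
  have h := corner_snd hc
  apply eq_of_forall_lt_iff
  intro j
  rw [← YoungDiagram.mem_iff_lt_rowLen, mem_del, YoungDiagram.mem_iff_lt_rowLen, Ne, Prod.ext_iff]
  split_ifs with hi
  · subst hi
    simp
    omega
  · simp [hi]

lemma colLen_del {μ : YoungDiagram} {c : ℕ × ℕ} (hc : c ∈ corners μ) :
    (del μ c hc).colLen 0 ≤ μ.colLen 0 := by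
  by_contra h
  push Not at h
  rw [← YoungDiagram.mem_iff_lt_colLen, mem_del, YoungDiagram.mem_iff_lt_colLen] at h
  omega

lemma sum_rowLen (μ : YoungDiagram) (L : ℕ) (hL : μ.colLen 0 ≤ L) :
    ∑ i ∈ Finset.range L, μ.rowLen i = μ.card := by
  unfold YoungDiagram.card
  rw [Finset.card_eq_sum_card_fiberwise (f := Prod.fst) (t := Finset.range L)]
  · apply Finset.sum_congr rfl
    intro i _
    rw [YoungDiagram.rowLen_eq_card]
    rfl
  · rintro ⟨i, j⟩ h
    have : (i, 0) ∈ μ := μ.isLowerSet (show (i, 0) ≤ (i, j) from ⟨le_rfl, Nat.zero_le _⟩) h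
    rw [YoungDiagram.mem_iff_lt_colLen] at this
    simp
    omega

/-! The recursion -/

lemma val_le {μ : YoungDiagram} (T : SYT μ) (d : ℕ × ℕ) : T.1 d ≤ μ.card := by
  by_cases h : d ∈ μ
  · exact (T.2.2.1.mapsTo (show d ∈ μ.cells from h)).2
  · rw [T.2.1 d h]; exact Nat.zero_le _

def ext (μ : YoungDiagram) (p : Σ c : {c // c ∈ corners μ}, SYT (del μ c.1 c.2)) : SYT μ := by
  obtain ⟨⟨c, hc⟩, T⟩ := p
  change SYT (del μ c hc) at T
  refine ⟨Function.update T.1 c μ.card, ?_, ?_, ?_, ?_⟩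
  · intro d hd
    have hdc : d ≠ c := by rintro rfl; exact hd (mem_corners.1 hc).1
    rw [Function.update_of_ne hdc]
    exact T.2.1 d (fun h => hd (mem_del.1 h).2)
  · have hcard := card_del hc
    have hb := T.2.2.1
    refine ⟨?_, ?_, ?_⟩
    · intro d hd
      by_cases hdc : d = c
      · subst hdc; rw [Function.update_self]; exact ⟨by omega, le_rfl⟩
      · rw [Function.update_of_ne hdc]
        have := hb.mapsTo (show d ∈ (del μ c hc).cells from mem_del.2 ⟨hdc, hd⟩)
        simp only [Set.mem_Icc] at this ⊢
        omega
    · intro d hd e he hde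
      by_cases hdc : d = c <;> by_cases hec : e = c
      · rw [hdc, hec]
      · subst hdc
        rw [Function.update_self, Function.update_of_ne hec] at hde
        have := val_le T e
        omega
      · subst hec
        rw [Function.update_self, Function.update_of_ne hdc] at hde
        have := val_le T d
        omega
      · rw [Function.update_of_ne hec, Function.update_of_ne hdc] at hde
        exact hb.injOn (mem_del.2 ⟨hdc, hd⟩) (mem_del.2 ⟨hec, he⟩) hde
    · intro v hv
      by_cases hvn : v = μ.card
      · exact ⟨c, (mem_corners.1 hc).1, by simp [hvn]⟩
      · obtain ⟨d, hd, rfl⟩ := hb.surjOn (show v ∈ Set.Icc 1 (del μ c hc).card by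
          simp only [Set.mem_Icc] at hv ⊢; omega)
        have hd' := mem_del.1 hd
        exact ⟨d, hd'.2, by rw [Function.update_of_ne hd'.1]⟩
  · intro i j₁ j₂ h1 h2 h
    have hcard := card_del hc
    have hn1 : (i, j₁) ≠ c := by
      rintro rfl
      exact (mem_corners.1 hc).2.2 (μ.isLowerSet (show (i, j₁ + 1) ≤ (i, j₂) from ⟨le_rfl, h⟩) h2)
    rw [Function.update_of_ne hn1]
    by_cases hn2 : (i, j₂) = c
    · rw [hn2, Function.update_self]
      have := val_le T (i, j₁)
      omega
    · rw [Function.update_of_ne hn2]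
      exact T.2.2.2.1 i j₁ j₂ (mem_del.2 ⟨hn1, h1⟩) (mem_del.2 ⟨hn2, h2⟩) h
  · intro i₁ i₂ j h1 h2 h
    have hcard := card_del hc
    have hn1 : (i₁, j) ≠ c := by
      rintro rfl
      exact (mem_corners.1 hc).2.1 (μ.isLowerSet (show (i₁ + 1, j) ≤ (i₂, j) from ⟨h, le_rfl⟩) h2)
    rw [Function.update_of_ne hn1]
    by_cases hn2 : (i₂, j) = c
    · rw [hn2, Function.update_self]
      have := val_le T (i₁, j)
      omega
    · rw [Function.update_of_ne hn2]
      exact T.2.2.2.2 i₁ i₂ j (mem_del.2 ⟨hn1, h1⟩) (mem_del.2 ⟨hn2, h2⟩) h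

lemma ext_val (μ : YoungDiagram) (c : ℕ × ℕ) (hc : c ∈ corners μ) (T : SYT (del μ c hc)) :
    (ext μ ⟨⟨c, hc⟩, T⟩).1 = Function.update T.1 c μ.card := rfl

lemma ext_bij (μ : YoungDiagram) (hμ : 0 < μ.card) : Function.Bijective (ext μ) := by
  constructor
  · rintro ⟨⟨c, hc⟩, T⟩ ⟨⟨c', hc'⟩, T'⟩ h
    change SYT (del μ c hc) at T
    change SYT (del μ c' hc') at T'
    have h1 := congrArg Subtype.val h
    rw [ext_val, ext_val] at h1
    have hcc : c = c' := by
      by_contra hne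
      have := congrFun h1 c
      rw [Function.update_self, Function.update_of_ne hne] at this
      have h2 := val_le T' c
      have h3 := card_del hc'
      omega
    subst hcc
    have : T = T' := by
      apply Subtype.ext
      funext d
      by_cases hd : d = c
      · subst hd
        rw [T.2.1 d (fun h => (mem_del.1 h).1 rfl), T'.2.1 d (fun h => (mem_del.1 h).1 rfl)]
      · have := congrFun h1 d
        rwa [Function.update_of_ne hd, Function.update_of_ne hd] at this
    rw [this]
  · intro T
    obtain ⟨c, hcμ, hcn⟩ := T.2.2.1.surjOn (show μ.card ∈ Set.Icc 1 μ.card from ⟨hμ, le_rfl⟩)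
    have hcμ' : c ∈ μ := hcμ
    have hc : c ∈ corners μ := by
      rw [mem_corners]
      refine ⟨hcμ', fun h => ?_, fun h => ?_⟩
      · have := T.2.2.2.2 c.1 (c.1 + 1) c.2 hcμ' h (Nat.lt_succ_self _)
        have h2 := val_le T (c.1 + 1, c.2)
        change T.1 c < _ at this
        omega
      · have := T.2.2.2.1 c.1 c.2 (c.2 + 1) hcμ' h (Nat.lt_succ_self _)
        have h2 := val_le T (c.1, c.2 + 1)
        change T.1 c < _ at this
        omega
    have hcard := card_del hc
    have hup : ∀ d, d ∈ del μ c hc → Function.update T.1 c 0 d = T.1 d := fun d hd =>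
      Function.update_of_ne (mem_del.1 hd).1 _ _
    refine ⟨⟨⟨c, hc⟩, ⟨Function.update T.1 c 0, ?_, ?_, ?_, ?_⟩⟩, ?_⟩
    · intro d hd
      by_cases hdc : d = c
      · subst hdc; simp
      · rw [Function.update_of_ne hdc]
        exact T.2.1 d (fun h => hd (mem_del.2 ⟨hdc, h⟩))
    · refine ⟨?_, ?_, ?_⟩
      · intro d hd
        have hd' := mem_del.1 hd
        rw [hup d hd]
        have := T.2.2.1.mapsTo (show d ∈ μ.cells from hd'.2)
        simp only [Set.mem_Icc] at this ⊢
        have hne : T.1 d ≠ μ.card := fun h =>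
          hd'.1 (T.2.2.1.injOn (show d ∈ μ.cells from hd'.2) hcμ (h.trans hcn.symm))
        omega
      · intro d hd e he h
        rw [hup d hd, hup e he] at h
        exact T.2.2.1.injOn (mem_del.1 hd).2 (mem_del.1 he).2 h
      · intro v hv
        simp only [Set.mem_Icc] at hv
        obtain ⟨d, hd, rfl⟩ := T.2.2.1.surjOn (show v ∈ Set.Icc 1 μ.card by
          simp only [Set.mem_Icc]; omega)
        have hdd : d ∈ del μ c hc := mem_del.2 ⟨by rintro rfl; omega, hd⟩
        exact ⟨d, hdd, hup d hdd⟩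
    · intro i j₁ j₂ h1 h2 h
      rw [hup _ h1, hup _ h2]
      exact T.2.2.2.1 i j₁ j₂ (mem_del.1 h1).2 (mem_del.1 h2).2 h
    · intro i₁ i₂ j h1 h2 h
      rw [hup _ h1, hup _ h2]
      exact T.2.2.2.2 i₁ i₂ j (mem_del.1 h1).2 (mem_del.1 h2).2 h
    · apply Subtype.ext
      rw [ext_val]
      simp [← hcn]

/-! The formula -/

def xx (μ : YoungDiagram) (L : ℕ) (i : ℕ) : ℚ := (μ.rowLen i : ℚ) + L - 1 - i

lemma xx_inj (μ : YoungDiagram) (L : ℕ) : Function.Injective (xx μ L) := by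
  apply StrictAnti.injective
  intro i j hij
  have := μ.rowLen_anti i j hij.le
  unfold xx
  have h1 : (μ.rowLen j : ℚ) ≤ μ.rowLen i := by exact_mod_cast this
  have h2 : (i : ℚ) < j := by exact_mod_cast hij
  linarith

def F (μ : YoungDiagram) (L : ℕ) : ℚ :=
  (Nat.factorial μ.card : ℚ) /
    (∏ i ∈ Finset.range L, (Nat.factorial (μ.rowLen i + (L - 1 - i)) : ℚ)) *
  ∏ p ∈ pairs L, (xx μ L p.1 - xx μ L p.2)

lemma F_del (μ : YoungDiagram) (L : ℕ) (hL : μ.colLen 0 ≤ L) (c : ℕ × ℕ) (hc : c ∈ corners μ) :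
    F (del μ c hc) L * μ.card = F μ L * (xx μ L c.1 * A (xx μ L) (-1) (Finset.range L) c.1) := by
  have hcs := corner_snd hc
  have hk : c.1 < L := by
    have : (c.1, 0) ∈ μ := by rw [YoungDiagram.mem_iff_lt_rowLen]; omega
    rw [YoungDiagram.mem_iff_lt_colLen] at this
    omega
  have hcard := card_del hc
  have hx : xx (del μ c hc) L = Function.update (xx μ L) c.1 (xx μ L c.1 + (-1)) := by
    funext i
    by_cases hi : i = c.1
    · subst hi
      rw [Function.update_self]
      unfold xx
      rw [rowLen_del, if_pos rfl, ← hcs]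
      push_cast
      ring_nf
      try simp
      try ring
    · rw [Function.update_of_ne hi]
      unfold xx
      rw [rowLen_del, if_neg hi]
  have hfac : (∏ i ∈ Finset.range L, (Nat.factorial (μ.rowLen i + (L - 1 - i)) : ℚ)) =
      xx μ L c.1 *
      (∏ i ∈ Finset.range L, (Nat.factorial ((del μ c hc).rowLen i + (L - 1 - i)) : ℚ)) := by
    have hm : c.1 ∈ Finset.range L := by simpa using hk
    rw [← Finset.mul_prod_erase _ _ hm, ← Finset.mul_prod_erase _ _ hm, ← mul_assoc]
    congr 1
    · rw [rowLen_del, if_pos rfl, ← hcs]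
      have : c.2 + 1 + (L - 1 - c.1) = (c.2 + 1 - 1 + (L - 1 - c.1)) + 1 := by omega
      rw [this, Nat.factorial_succ]
      unfold xx
      rw [← hcs]
      push_cast
      congr 1
      have h3 : ((L - 1 - c.1 : ℕ) : ℚ) = L - 1 - c.1 := by
        rw [Nat.cast_sub (by omega), Nat.cast_sub (by omega)]; simp
      rw [h3]
      ring
    · apply Finset.prod_congr rfl
      intro i hi
      rw [rowLen_del, if_neg (Finset.ne_of_mem_erase hi)]
  have hpos : (∏ i ∈ Finset.range L, (Nat.factorial (μ.rowLen i + (L - 1 - i)) : ℚ)) ≠ 0 :=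
    Finset.prod_ne_zero_iff.2 (fun i _ => by exact_mod_cast Nat.factorial_ne_zero _)
  unfold F
  rw [hx, vdm_ratio _ (xx_inj μ L) _ _ _ hk, ← hcard, Nat.factorial_succ]
  rw [hfac] at hpos ⊢
  have h1 := left_ne_zero_of_mul hpos
  have h2 := right_ne_zero_of_mul hpos
  push_cast
  field_simp

lemma sum_corners (μ : YoungDiagram) (L : ℕ) (hL : μ.colLen 0 ≤ L) :
    ∑ c ∈ corners μ, xx μ L c.1 * A (xx μ L) (-1) (Finset.range L) c.1 = μ.card := by
  have h1 : ∑ c ∈ corners μ, xx μ L c.1 * A (xx μ L) (-1) (Finset.range L) c.1 =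
      ∑ k ∈ Finset.range L, xx μ L k * A (xx μ L) (-1) (Finset.range L) k := by
    apply Finset.sum_of_injOn Prod.fst
    · intro c hc d hd h
      have h1 := corner_snd hc
      have h2 := corner_snd hd
      rw [h] at h1
      exact Prod.ext h (by omega)
    · intro c hc
      have hcs := corner_snd hc
      have : (c.1, 0) ∈ μ := by rw [YoungDiagram.mem_iff_lt_rowLen]; omega
      rw [YoungDiagram.mem_iff_lt_colLen] at this
      simp
      omega
    · intro k hk hn
      have hkL : k < L := by simpa using hk
      have hkey : (k + 1 < L ∧ μ.rowLen (k + 1) = μ.rowLen k) ∨ (k + 1 = L ∧ μ.rowLen k = 0) := by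
        have hanti := μ.rowLen_anti k (k + 1) (by omega)
        by_cases hr : μ.rowLen k = 0
        · omega
        · left
          have hc : (k, μ.rowLen k - 1) ∉ corners μ := fun h => hn ⟨_, h, rfl⟩
          rw [mem_corners] at hc
          simp only [YoungDiagram.mem_iff_lt_rowLen] at hc
          have h2 : μ.rowLen (k + 1) = μ.rowLen k := by omega
          have : (k + 1, 0) ∈ μ := by rw [YoungDiagram.mem_iff_lt_rowLen]; omega
          rw [YoungDiagram.mem_iff_lt_colLen] at this
          omega
      rcases hkey with ⟨h1, h2⟩ | ⟨h1, h2⟩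
      · apply mul_eq_zero_of_right
        unfold A
        apply Finset.prod_eq_zero (i := k + 1) (by simp [h1])
        unfold xx
        rw [h2]
        push_cast
        rw [show ((μ.rowLen k : ℚ) + L - 1 - k - (μ.rowLen k + L - 1 - (k + 1))) = 1 by ring]
        norm_num
      · apply mul_eq_zero_of_left
        unfold xx
        rw [h2, ← h1]
        push_cast
        ring
    · intro _ _; rfl
  rw [h1, sumxA _ (xx_inj μ L)]
  have hs : ∀ M : ℕ, ∑ k ∈ Finset.range M, xx μ L k =
      ((∑ k ∈ Finset.range M, μ.rowLen k : ℕ) : ℚ) + M * (L - 1) - M * (M - 1) / 2 := by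
    intro M
    induction M with
    | zero => simp
    | succ M ih =>
      rw [Finset.sum_range_succ, Finset.sum_range_succ, ih]
      unfold xx
      push_cast
      ring
  rw [hs, sum_rowLen μ L hL, Finset.card_range]
  ring

lemma F_zero (μ : YoungDiagram) (L : ℕ) (hL : μ.colLen 0 ≤ L) (h : μ.card = 0) : F μ L = 1 := by
  have hr : ∀ i, μ.rowLen i = 0 := by
    intro i
    by_contra hne
    have : (i, 0) ∈ μ := by rw [YoungDiagram.mem_iff_lt_rowLen]; omega
    have h2 : μ.cells = ∅ := Finset.card_eq_zero.1 h
    rw [← YoungDiagram.mem_cells, h2] at this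
    simp at this
  have e1 : (∏ i ∈ Finset.range L, (Nat.factorial (μ.rowLen i + (L - 1 - i)) : ℚ)) =
      ∏ j ∈ Finset.range L, (Nat.factorial j : ℚ) := by
    rw [← Finset.prod_range_reflect (fun j => (Nat.factorial j : ℚ))]
    exact Finset.prod_congr rfl (fun i _ => by rw [hr, zero_add])
  have e2 : ∏ p ∈ pairs L, (xx μ L p.1 - xx μ L p.2) =
      ∏ j ∈ Finset.range L, (Nat.factorial j : ℚ) := by
    unfold pairs
    rw [Finset.prod_filter, Finset.prod_product_right]
    apply Finset.prod_congr rfl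
    intro j hj
    rw [← Finset.prod_filter]
    have : (Finset.range L).filter (fun i => i < j) = Finset.range j := by
      ext i
      simp at hj ⊢
      omega
    simp only
    rw [this, ← Finset.prod_range_add_one_eq_factorial, ← Finset.prod_range_reflect]
    push_cast
    apply Finset.prod_congr rfl
    intro i hi
    simp at hi
    unfold xx
    rw [hr, hr, Nat.cast_sub (by omega), Nat.cast_sub (by omega)]
    push_cast
    ring
  have hpos : (∏ j ∈ Finset.range L, (Nat.factorial j : ℚ)) ≠ 0 :=
    Finset.prod_ne_zero_iff.2 (fun i _ => by exact_mod_cast Nat.factorial_ne_zero _)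
  unfold F
  rw [e1, e2, h]
  field_simp
  simp

lemma main (n : ℕ) : ∀ μ : YoungDiagram, μ.card = n →
    Finite (SYT μ) ∧ ∀ L, μ.colLen 0 ≤ L → (Nat.card (SYT μ) : ℚ) = F μ L := by
  induction n with
  | zero =>
    intro μ h
    have hc : μ.cells = ∅ := Finset.card_eq_zero.1 h
    have hm : ∀ c, c ∉ μ := fun c hc' => by
      rw [← YoungDiagram.mem_cells, hc] at hc'; simp at hc'
    have : Unique (SYT μ) :=
      { default := ⟨fun _ => 0, fun _ _ => rfl, by rw [hc, h]; simp,
          fun i j _ hi => (hm _ hi).elim, fun i j _ hi => (hm _ hi).elim⟩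
        uniq := fun T => by
          apply Subtype.ext
          funext c
          rw [T.2.1 c (hm c)] }
    refine ⟨inferInstance, fun L hL => ?_⟩
    rw [F_zero μ L hL h, Nat.card_unique]
    simp
  | succ n ih =>
    intro μ h
    have hd : ∀ c : {c // c ∈ corners μ}, (del μ c.1 c.2).card = n := fun c => by
      have := card_del c.2; omega
    have hfin : ∀ c : {c // c ∈ corners μ}, Finite (SYT (del μ c.1 c.2)) :=
      fun c => (ih _ (hd c)).1
    have hb := ext_bij μ (by omega)
    refine ⟨Finite.of_surjective _ hb.2, fun L hL => ?_⟩
    rw [← Nat.card_congr (Equiv.ofBijective _ hb), Nat.card_sigma]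
    have hne : (μ.card : ℚ) ≠ 0 := by rw [h]; exact_mod_cast Nat.succ_ne_zero n
    apply mul_right_cancel₀ hne
    push_cast
    rw [Finset.sum_mul]
    have : ∀ c : {c // c ∈ corners μ}, (Nat.card (SYT (del μ c.1 c.2)) : ℚ) * μ.card =
        F μ L * (xx μ L c.1.1 * A (xx μ L) (-1) (Finset.range L) c.1.1) := fun c => by
      rw [(ih _ (hd c)).2 L ((colLen_del c.2).trans hL), F_del μ L hL]
    rw [Finset.sum_congr rfl (fun c _ => this c), ← Finset.mul_sum]
    congr 1
    rw [← sum_corners μ L hL]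
    exact Finset.sum_coe_sort (corners μ)
      (fun c => xx μ L c.1 * A (xx μ L) (-1) (Finset.range L) c.1)

end HK


/-- The number of standard Young tableaux of shape `μ`: fillings of the cells of `μ`
with the numbers `1, …, μ.card`, each used exactly once, strictly increasing along
each row (left to right) and each column (top to bottom). -/
noncomputable def sytCard (μ : YoungDiagram) : ℕ :=
  Nat.card {T : ℕ × ℕ → ℕ //
    (∀ c, c ∉ μ → T c = 0) ∧
    Set.BijOn T (↑μ.cells) (Set.Icc 1 μ.card) ∧
    (∀ i j₁ j₂, (i, j₁) ∈ μ → (i, j₂) ∈ μ → j₁ < j₂ → T (i, j₁) < T (i, j₂)) ∧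
    (∀ i₁ i₂ j, (i₁, j) ∈ μ → (i₂, j) ∈ μ → i₁ < i₂ → T (i₁, j) < T (i₂, j))}

/-- The hook length of the cell `(i, j)` (0-indexed) of the Young diagram `μ`:
the number of cells directly to the right in its row, plus the number of cells
directly below in its column, plus 1 for the cell itself. -/
def hook (μ : YoungDiagram) (i j : ℕ) : ℕ :=
  (μ.rowLen i - j) + (μ.colLen j - i) - 1

/-- If `λ` is a partition of `n` with `ℓ` nonzero parts then
`f^λ = n! / (h(1,1)! ⋯ h(ℓ,1)!) * ∏_{1 ≤ j₁ < j₂ ≤ ℓ} (h(j₁,1) − h(j₂,1))`,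
where `h(i,1)` is the hook length of the cell in row `i` of the first column.
(Here rows are 0-indexed, and `ℓ = μ.colLen 0` is the number of nonzero rows.) -/
theorem stmt_2 (μ : YoungDiagram) :
    (sytCard μ : ℚ) =
      (Nat.factorial μ.card : ℚ) /
        (∏ i ∈ Finset.range (μ.colLen 0), (Nat.factorial (hook μ i 0) : ℚ)) *
      ∏ p ∈ (Finset.range (μ.colLen 0) ×ˢ Finset.range (μ.colLen 0)).filter
          (fun p => p.1 < p.2),
        ((hook μ p.1 0 : ℚ) - (hook μ p.2 0 : ℚ)) := by

  have h := (HK.main μ.card μ rfl).2 (μ.colLen 0) le_rfl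
  have hh : ∀ i, i < μ.colLen 0 → hook μ i 0 = μ.rowLen i + (μ.colLen 0 - 1 - i) := by
    intro i hi
    unfold hook
    omega
  have hx : ∀ i, i < μ.colLen 0 → (hook μ i 0 : ℚ) = HK.xx μ (μ.colLen 0) i := by
    intro i hi
    rw [hh i hi]
    unfold HK.xx
    rw [Nat.cast_add, Nat.cast_sub (by omega), Nat.cast_sub (by omega)]
    push_cast
    ring
  unfold sytCard
  refine h.trans ?_
  unfold HK.F HK.pairs
  congr 1
  · congr 1
    apply Finset.prod_congr rfl
    intro i hi
    rw [hh i (Finset.mem_range.1 hi)]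
  · apply Finset.prod_congr rfl
    intro p hp
    simp only [Finset.mem_filter, Finset.mem_product, Finset.mem_range] at hp
    rw [hx _ hp.1.1, hx _ hp.1.2]
end

section
/- Let λ be a partition with ℓ nonzero parts. Then the product of the hook lengths over all cells of the Young diagram of λ equals (h(1,1)! · h(2,1)! ⋯ h(ℓ,1)!) / ∏_{1 ≤ j_1 < j_2 ≤ ℓ} (h(j_1,1) − h(j_2,1)), where h(i,1) denotes the hook length of the cell in row i of the first column. -/
theorem icc_fact (n : ℕ) : ∏ x ∈ Finset.Icc 1 n, x = Nat.factorial n := by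
  induction n with
  | zero => simp
  | succ k ih =>
    rw [Finset.prod_Icc_succ_top (by omega), ih, Nat.factorial_succ, mul_comm]

theorem mem_aux (μ : YoungDiagram) (i j : ℕ) : j < μ.rowLen i ↔ i < μ.colLen j := by
  rw [← YoungDiagram.mem_iff_lt_rowLen, YoungDiagram.mem_iff_lt_colLen]

theorem row_prod (μ : YoungDiagram) (i : ℕ) (hi : i < μ.colLen 0) :
    (∏ j ∈ Finset.range (μ.rowLen i), hook μ i j) *
      (∏ k ∈ Finset.Ioo i (μ.colLen 0), (hook μ i 0 - hook μ k 0)) =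
      Nat.factorial (hook μ i 0) := by
  classical
  have injA : Set.InjOn (fun j => hook μ i j) (Finset.range (μ.rowLen i) : Set ℕ) := by
    intro a ha b hb hab
    simp only [Finset.coe_range, Set.mem_Iio] at ha hb
    simp only [hook] at hab
    have h1 := (mem_aux μ i a).1 ha
    have h2 := (mem_aux μ i b).1 hb
    rcases le_total a b with h | h
    · have := μ.colLen_anti a b h
      omega
    · have := μ.colLen_anti b a h
      omega
  have injB : Set.InjOn (fun k => hook μ i 0 - hook μ k 0)
      (Finset.Ioo i (μ.colLen 0) : Set ℕ) := by
    intro a ha b hb hab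
    simp only [Finset.coe_Ioo, Set.mem_Ioo] at ha hb
    simp only [hook] at hab
    have h1 := μ.rowLen_anti i a ha.1.le
    have h2 := μ.rowLen_anti i b hb.1.le
    rcases le_total a b with h | h
    · have := μ.rowLen_anti a b h
      omega
    · have := μ.rowLen_anti b a h
      omega
  have disj : Disjoint ((Finset.range (μ.rowLen i)).image (fun j => hook μ i j))
      ((Finset.Ioo i (μ.colLen 0)).image (fun k => hook μ i 0 - hook μ k 0)) := by
    rw [Finset.disjoint_left]
    intro x hx hy
    simp only [Finset.mem_image, Finset.mem_range, Finset.mem_Ioo] at hx hy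
    obtain ⟨j, hj, rfl⟩ := hx
    obtain ⟨k, hk, he⟩ := hy
    simp only [hook] at he
    have h1 := μ.rowLen_anti i k hk.1.le
    have h2 := mem_aux μ k j
    have h3 := (mem_aux μ i j).1 hj
    omega
  have un : ((Finset.range (μ.rowLen i)).image (fun j => hook μ i j)) ∪
      ((Finset.Ioo i (μ.colLen 0)).image (fun k => hook μ i 0 - hook μ k 0))
      = Finset.Icc 1 (hook μ i 0) := by
    apply Finset.eq_of_subset_of_card_le
    · intro x hx
      simp only [Finset.mem_union, Finset.mem_image, Finset.mem_range, Finset.mem_Ioo] at hx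
      rw [Finset.mem_Icc]
      rcases hx with ⟨j, hj, rfl⟩ | ⟨k, hk, rfl⟩
      · have h3 := (mem_aux μ i j).1 hj
        have := μ.colLen_anti 0 j (Nat.zero_le _)
        simp only [hook]
        omega
      · have h1 := μ.rowLen_anti i k hk.1.le
        simp only [hook]
        omega
    · rw [Finset.card_union_of_disjoint disj, Finset.card_image_of_injOn injA,
        Finset.card_image_of_injOn injB]
      simp only [Nat.card_Icc, Finset.card_range, Nat.card_Ioo, hook]
      omega
  rw [← icc_fact, ← un, Finset.prod_union disj,
    Finset.prod_image injA, Finset.prod_image injB]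

/-- For a partition `λ` with `ℓ` nonzero parts, the product of the hook lengths over
all cells of the Young diagram of `λ` equals
`(h(1,1)! ⋯ h(ℓ,1)!) / ∏_{1 ≤ j₁ < j₂ ≤ ℓ} (h(j₁,1) − h(j₂,1))`,
where `h(i,1)` is the hook length of the cell in row `i` of the first column.
(Here rows are 0-indexed, and `ℓ = μ.colLen 0` is the number of nonzero rows.) -/
theorem stmt_3 (μ : YoungDiagram) :
    (∏ c ∈ μ.cells, (hook μ c.1 c.2 : ℚ)) =
      (∏ i ∈ Finset.range (μ.colLen 0), (Nat.factorial (hook μ i 0) : ℚ)) /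
      ∏ p ∈ (Finset.range (μ.colLen 0) ×ˢ Finset.range (μ.colLen 0)).filter
          (fun p => p.1 < p.2),
        ((hook μ p.1 0 : ℚ) - (hook μ p.2 0 : ℚ)) := by
  have hlt : ∀ i k, i < k → k < μ.colLen 0 → hook μ k 0 < hook μ i 0 := by
    intro i k h1 h2
    have := μ.rowLen_anti i k h1.le
    simp only [hook]
    omega
  have hden : (∏ p ∈ (Finset.range (μ.colLen 0) ×ˢ Finset.range (μ.colLen 0)).filter
          (fun p => p.1 < p.2),
        ((hook μ p.1 0 : ℚ) - (hook μ p.2 0 : ℚ))) ≠ 0 := by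
    rw [Finset.prod_ne_zero_iff]
    intro p hp
    simp only [Finset.mem_filter, Finset.mem_product, Finset.mem_range] at hp
    have := hlt p.1 p.2 hp.2 hp.1.2
    have h2 : (hook μ p.2 0 : ℚ) < hook μ p.1 0 := by exact_mod_cast this
    exact (sub_pos.2 h2).ne'
  rw [eq_div_iff hden]
  have e1 : (∏ c ∈ μ.cells, (hook μ c.1 c.2 : ℚ)) =
      ∏ i ∈ Finset.range (μ.colLen 0), ∏ j ∈ Finset.range (μ.rowLen i), (hook μ i j : ℚ) := by
    apply Finset.prod_finset_product' (f := fun i j => (hook μ i j : ℚ))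
    intro p
    rw [YoungDiagram.mem_cells, Finset.mem_range, Finset.mem_range]
    have h1 : p ∈ μ ↔ p.2 < μ.rowLen p.1 := YoungDiagram.mem_iff_lt_rowLen
    have h2 := mem_aux μ p.1 p.2
    have := μ.colLen_anti 0 p.2 (Nat.zero_le _)
    rw [h1]
    omega
  have e2 : (∏ p ∈ (Finset.range (μ.colLen 0) ×ˢ Finset.range (μ.colLen 0)).filter
          (fun p => p.1 < p.2), ((hook μ p.1 0 : ℚ) - (hook μ p.2 0 : ℚ))) =
      ∏ i ∈ Finset.range (μ.colLen 0), ∏ k ∈ Finset.Ioo i (μ.colLen 0),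
        ((hook μ i 0 : ℚ) - (hook μ k 0 : ℚ)) := by
    apply Finset.prod_finset_product' (f := fun i k => ((hook μ i 0 : ℚ) - (hook μ k 0 : ℚ)))
    intro p
    simp only [Finset.mem_filter, Finset.mem_product, Finset.mem_range, Finset.mem_Ioo]
    tauto
  rw [e1, e2, ← Finset.prod_mul_distrib]
  apply Finset.prod_congr rfl
  intro i hi
  rw [← row_prod μ i (Finset.mem_range.1 hi)]
  push_cast
  congr 1
  apply Finset.prod_congr rfl
  intro k hk
  rw [Finset.mem_Ioo] at hk
  rw [Nat.cast_sub (hlt i k hk.1 hk.2).le]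
end

section
/- Let m, n be positive integers and for ⌈n/2⌉ ≤ k ≤ n define a_k = ∏_{0 ≤ i_1, i_2 ≤ m-1} (2k − n + 1 + i_1 + i_2). Then for every integer k with ⌈n/2⌉ < k < n, one has a_k^2 ≥ a_{k-1} · a_{k+1}. -/
/-- `a k = ∏_{0 ≤ i₁, i₂ ≤ m-1} (2k − n + 1 + i₁ + i₂)`, as an integer. -/
def aSeq (m n k : ℕ) : ℤ :=
  ∏ p ∈ Finset.range m ×ˢ Finset.range m,
    (2 * (k : ℤ) - (n : ℤ) + 1 + (p.1 : ℤ) + (p.2 : ℤ))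

/-- For positive integers `m, n` and `⌈n/2⌉ < k < n`, the sequence
`a_k = ∏_{0 ≤ i₁, i₂ ≤ m-1} (2k − n + 1 + i₁ + i₂)` satisfies `a_k² ≥ a_{k-1} ⋅ a_{k+1}`. -/
theorem stmt_6 (m n k : ℕ) (hm : 0 < m) (hn : 0 < n)
    (hk₁ : (n + 1) / 2 < k) (hk₂ : k < n) :
    aSeq m n k ^ 2 ≥ aSeq m n (k - 1) * aSeq m n (k + 1) := by
  unfold aSeq
  rw [ge_iff_le, ← Finset.prod_mul_distrib, ← Finset.prod_pow]
  have h1 : ((k - 1 : ℕ) : ℤ) = (k : ℤ) - 1 := by omega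
  have h2 : (n : ℤ) + 2 ≤ 2 * (k : ℤ) := by omega
  apply Finset.prod_le_prod
  · intro p _
    rw [h1]
    push_cast
    apply mul_nonneg <;> omega
  · intro p _
    rw [h1]
    push_cast
    nlinarith
end

section
/- Let m, n be positive integers and for 1 ≤ k ≤ n define b_k = (m(n−k))! · ∏_{i=0}^{m-1} (m(n−k)+k+i). Then for every integer k with 1 < k < n, one has b_k^2 ≤ b_{k-1} · b_{k+1}; that is, the sequence (b_k) is log-convex. -/
/-- `b_k = (m(n−k))! ⋅ ∏_{i=0}^{m-1} (m(n−k)+k+i)`. -/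
def bSeq (m n k : ℕ) : ℕ :=
  Nat.factorial (m * (n - k)) * ∏ i ∈ Finset.range m, (m * (n - k) + k + i)

theorem bSeq_aux (a p c : ℕ) :
    a * (a + p + 1 + c) ^ 2 ≤ (a + p + 1) * ((a + p + 1 + c + p) * (a + c + 1)) := by
  obtain ⟨y, hy⟩ : ∃ y, y = a + c + 1 := ⟨_, rfl⟩
  have h1 : a + p + 1 + c = y + p := by omega
  rw [h1, ← hy]
  have h2 : a + p + 1 ≤ y + p := by omega
  have h3 : p * p * (a + p + 1) ≤ (p + 1) * (y + p) ^ 2 := by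
    have h4 : p * p ≤ (p + 1) * (y + p) := Nat.mul_le_mul (by omega) (by omega)
    calc p * p * (a + p + 1) ≤ (p + 1) * (y + p) * (y + p) := Nat.mul_le_mul h4 h2
      _ = _ := by ring
  nlinarith

/-- For positive integers `m, n` and `1 < k < n`, the sequence
`b_k = (m(n−k))! ⋅ ∏_{i=0}^{m-1} (m(n−k)+k+i)` satisfies `b_k² ≤ b_{k-1} ⋅ b_{k+1}`,
i.e. it is log-convex. -/
theorem stmt_11 (m n k : ℕ) (hm : 0 < m) (hn : 0 < n)
    (hk₁ : 1 < k) (hk₂ : k < n) :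
    bSeq m n k ^ 2 ≤ bSeq m n (k - 1) * bSeq m n (k + 1) := by
  obtain ⟨c, rfl⟩ : ∃ c, k = c + 1 := ⟨k - 1, by omega⟩
  obtain ⟨d, rfl⟩ : ∃ d, n = c + 2 + d := ⟨n - (c + 2), by omega⟩
  obtain ⟨p, rfl⟩ : ∃ p, m = p + 1 := ⟨m - 1, by omega⟩
  unfold bSeq
  have e1 : c + 2 + d - (c + 1) = d + 1 := by omega
  have e2 : c + 2 + d - (c + 1 - 1) = d + 2 := by omega
  have e3 : c + 2 + d - (c + 1 + 1) = d := by omega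
  rw [e1, e2, e3, Nat.add_sub_cancel]
  obtain ⟨M, hM⟩ : ∃ M, M = (p + 1) * d := ⟨_, rfl⟩
  have f1 : (p + 1) * (d + 1) = M + (p + 1) := by rw [hM]; ring
  have f2 : (p + 1) * (d + 2) = M + (p + 1) + (p + 1) := by rw [hM]; ring
  rw [f1, f2, ← hM]
  have g : ∀ A : ℕ, (A + (p + 1)).factorial
      = A.factorial * ∏ i ∈ Finset.range (p + 1), (A + 1 + i) := by
    intro A
    rw [← Nat.ascFactorial_eq_prod_range, Nat.factorial_mul_ascFactorial]
  have key : (∏ i ∈ Finset.range (p + 1), (M + 1 + i)) *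
      (∏ i ∈ Finset.range (p + 1), (M + (p + 1) + (c + 1) + i)) ^ 2 ≤
      (∏ i ∈ Finset.range (p + 1), (M + (p + 1) + 1 + i)) *
      ((∏ i ∈ Finset.range (p + 1), (M + (p + 1) + (p + 1) + c + i)) *
      (∏ i ∈ Finset.range (p + 1), (M + (c + 1 + 1) + i))) := by
    rw [← Finset.prod_pow, ← Finset.prod_mul_distrib, ← Finset.prod_mul_distrib,
      ← Finset.prod_mul_distrib]
    apply Finset.prod_le_prod'
    intro i _
    have := bSeq_aux (M + 1 + i) p c
    have h1 : M + (p + 1) + (c + 1) + i = M + 1 + i + p + 1 + c := by omega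
    have h2 : M + (p + 1) + 1 + i = M + 1 + i + p + 1 := by omega
    have h3 : M + (p + 1) + (p + 1) + c + i = M + 1 + i + p + 1 + c + p := by omega
    have h4 : M + (c + 1 + 1) + i = M + 1 + i + c + 1 := by omega
    rw [h1, h2, h3, h4]
    exact this
  rw [g (M + (p + 1)), g M]
  generalize (∏ i ∈ Finset.range (p + 1), (M + 1 + i)) = P at *
  generalize (∏ i ∈ Finset.range (p + 1), (M + (p + 1) + (c + 1) + i)) = Q at *
  generalize (∏ i ∈ Finset.range (p + 1), (M + (p + 1) + 1 + i)) = R at *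
  generalize (∏ i ∈ Finset.range (p + 1), (M + (p + 1) + (p + 1) + c + i)) = S at *
  generalize (∏ i ∈ Finset.range (p + 1), (M + (c + 1 + 1) + i)) = T at *
  calc (M.factorial * P * Q) ^ 2 = M.factorial ^ 2 * P * (P * Q ^ 2) := by ring
    _ ≤ M.factorial ^ 2 * P * (R * (S * T)) := Nat.mul_le_mul_left _ key
    _ = _ := by ring
end

section
/- Let m, n be positive integers and define b : [1,n] → ℝ by b(z) = Γ(mn − mz + 1) · Γ(mn − mz + z) / Γ(mn − mz + z + m), where Γ is the real Gamma function (all three arguments are positive for z ∈ [1,n]). Then the function z ↦ ln b(z) is convex on the interval [1,n]. -/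
lemma aux_log (y : ℝ) (hy : 0 < y) (k : ℕ) :
    Real.log (Real.Gamma (y + k)) =
      Real.log (Real.Gamma y) + ∑ i ∈ Finset.range k, Real.log (y + i) := by
  induction k with
  | zero => simp
  | succ k ih =>
    have h : 0 < y + k := by positivity
    rw [Finset.sum_range_succ, ← add_assoc, ← ih]
    push_cast
    rw [← add_assoc, Real.Gamma_add_one h.ne',
      Real.log_mul h.ne' (Real.Gamma_pos_of_pos h).ne', add_comm]

/-- For positive integers `m, n`, the function
`b(z) = Γ(mn − mz + 1) ⋅ Γ(mn − mz + z) / Γ(mn − mz + z + m)` is log-convex on `[1, n]`: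
the function `z ↦ ln b(z)` is convex on the interval `[1, n]`. -/
theorem stmt_13 (m n : ℕ) (hm : 0 < m) (hn : 0 < n) :
    ConvexOn ℝ (Set.Icc (1 : ℝ) (n : ℝ)) fun z : ℝ =>
      Real.log (Real.Gamma ((m : ℝ) * n - m * z + 1) *
          Real.Gamma ((m : ℝ) * n - m * z + z) /
          Real.Gamma ((m : ℝ) * n - m * z + z + m)) := by
  have key : ∀ z ∈ Set.Icc (1 : ℝ) (n : ℝ), 0 < (m : ℝ) * n - m * z + 1 ∧
      0 < (m : ℝ) * n - m * z + z := by
    rintro z ⟨h1, h2⟩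
    have : (m : ℝ) * z ≤ m * n := by gcongr
    constructor <;> linarith
  have eq : ∀ z ∈ Set.Icc (1 : ℝ) (n : ℝ),
      Real.log (Real.Gamma ((m : ℝ) * n - m * z + 1) *
          Real.Gamma ((m : ℝ) * n - m * z + z) /
          Real.Gamma ((m : ℝ) * n - m * z + z + m)) =
      Real.log (Real.Gamma ((m : ℝ) * n - m * z + 1)) -
        ∑ i ∈ Finset.range m, Real.log ((m : ℝ) * n - m * z + z + i) := by
    intro z hz
    obtain ⟨h1, h2⟩ := key z hz
    have h3 : 0 < (m : ℝ) * n - m * z + z + m := by positivity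
    have g1 := (Real.Gamma_pos_of_pos h1).ne'
    have g2 := (Real.Gamma_pos_of_pos h2).ne'
    have g3 := (Real.Gamma_pos_of_pos h3).ne'
    rw [Real.log_div (mul_ne_zero g1 g2) g3, Real.log_mul g1 g2, aux_log _ h2]
    ring
  refine ⟨convex_Icc _ _, ?_⟩
  intro x hx y hy a b ha hb hab
  have hz := convex_Icc (1 : ℝ) (n : ℝ) hx hy ha hb hab
  simp only
  rw [eq x hx, eq y hy, eq _ hz]
  obtain ⟨x1, x2⟩ := key x hx
  obtain ⟨y1, y2⟩ := key y hy
  have hb' : b = 1 - a := by linarith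
  have A := Real.convexOn_log_Gamma.2 (Set.mem_Ioi.2 x1) (Set.mem_Ioi.2 y1) ha hb hab
  have B : ∑ i ∈ Finset.range m, (a * Real.log ((m : ℝ) * n - m * x + x + i) +
        b * Real.log ((m : ℝ) * n - m * y + y + i)) ≤
      ∑ i ∈ Finset.range m, Real.log ((m : ℝ) * n - m * (a • x + b • y) + (a • x + b • y) + i) := by
    refine Finset.sum_le_sum fun i _ => ?_
    have p : 0 < (m : ℝ) * n - m * x + x + i := by positivity
    have q : 0 < (m : ℝ) * n - m * y + y + i := by positivity
    have C := strictConcaveOn_log_Ioi.concaveOn.2 (Set.mem_Ioi.2 p) (Set.mem_Ioi.2 q) ha hb hab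
    simp only [smul_eq_mul] at C ⊢
    convert C using 2
    subst hb'; ring
  rw [Finset.sum_add_distrib, ← Finset.mul_sum, ← Finset.mul_sum] at B
  simp only [smul_eq_mul, Function.comp] at A B ⊢
  have e : (m : ℝ) * n - m * (a * x + b * y) + 1 =
      a * ((m : ℝ) * n - m * x + 1) + b * ((m : ℝ) * n - m * y + 1) := by
    subst hb'; ring
  rw [e]
  linarith
end
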